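/- Let I′ = aₙIₙ ⊕ … ⊕ a₀I₀ and I = cₙIₙ ⊕ … ⊕ c₀I₀ be preinjective Kronecker representations. Then I′ is a subfactor of I (there exists a representation L with a monomorphism I′ → L and an epimorphism I → L) if and only if b₁ ≤ ½(Σ_{i=1}^{n}(i+1)cᵢ − Σ_{i=2}^{n}(i+1)bᵢ) and b₀ ≥ a₀, where bₙ = min(aₙ,cₙ), b_t = ⌊min((Σ_{i=t}^{n} i·aᵢ − Σ_{i=t+1}^{n} i·bᵢ)/t, (Σ_{i=t}^{n}(i+1)cᵢ − Σ_{i=t+1}^{n}(i+1)bᵢ)/(t+1))⌋ for 2 ≤ t < n, b₁ = Σ_{i=1}^{n} i·aᵢ − Σ_{i=2}^{n} i·bᵢ, and b₀ = Σ_{i=0}^{n}(i+1)cᵢ − Σ_{i=1}^{n}(i+1)bᵢ. Moreover in this case all b_t are non-negative and L = bₙIₙ ⊕ … ⊕ b₀I₀ is a linking module. -/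

import Mathlib

open Matrix Finset

/-- A finite-dimensional representation of the Kronecker quiver over `k`:
two vector spaces `k^{d1}`, `k^{d2}` and two linear maps `k^{d2} → k^{d1}`
given by the matrices `A` and `B`. -/
structure KRep (k : Type) [Field k] where
  d1 : ℕ
  d2 : ℕ
  A : Matrix (Fin d1) (Fin d2) k
  B : Matrix (Fin d1) (Fin d2) k

/-- A morphism of Kronecker representations `M → N`. -/
structure KHom {k : Type} [Field k] (M N : KRep k) where
  f1 : Matrix (Fin N.d1) (Fin M.d1) k
  f2 : Matrix (Fin N.d2) (Fin M.d2) k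
  comm_a : f1 * M.A = N.A * f2
  comm_b : f1 * M.B = N.B * f2

variable {k : Type} [Field k]

/-- A monomorphism: both components injective. -/
def KHom.Mono {M N : KRep k} (f : KHom M N) : Prop :=
  Function.Injective f.f1.mulVecLin ∧ Function.Injective f.f2.mulVecLin

/-- An epimorphism: both components surjective. -/
def KHom.Epi {M N : KRep k} (f : KHom M N) : Prop :=
  Function.Surjective f.f1.mulVecLin ∧ Function.Surjective f.f2.mulVecLin

/-- Isomorphism of Kronecker representations. -/
def KIso (M N : KRep k) : Prop :=
  ∃ f : KHom M N, Function.Bijective f.f1.mulVecLin ∧ Function.Bijective f.f2.mulVecLin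

/-- `SES N Y M` : there is a short exact sequence `0 → N → Y → M → 0`. -/
def SES (N Y M : KRep k) : Prop :=
  ∃ (f : KHom N Y) (g : KHom Y M), f.Mono ∧ g.Epi ∧
    LinearMap.range f.f1.mulVecLin = LinearMap.ker g.f1.mulVecLin ∧
    LinearMap.range f.f2.mulVecLin = LinearMap.ker g.f2.mulVecLin

/-- The zero representation. -/
def KRep.zero : KRep k := ⟨0, 0, 0, 0⟩

/-- Direct sum of two Kronecker representations (block diagonal matrices). -/
def KRep.dsum (M N : KRep k) : KRep k where
  d1 := M.d1 + N.d1
  d2 := M.d2 + N.d2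
  A := Matrix.reindex finSumFinEquiv finSumFinEquiv (Matrix.fromBlocks M.A 0 0 N.A)
  B := Matrix.reindex finSumFinEquiv finSumFinEquiv (Matrix.fromBlocks M.B 0 0 N.B)

/-- Direct sum of a list of Kronecker representations. -/
def KRep.dsumList (l : List (KRep k)) : KRep k := l.foldr KRep.dsum KRep.zero

/-- The preprojective indecomposable `P n`, with maps `k^n → k^{n+1}`
given by the matrices `(I_n ; 0)` and `(0 ; I_n)`. -/
def KRep.P (k : Type) [Field k] (n : ℕ) : KRep k where
  d1 := n + 1
  d2 := n
  A := Matrix.of fun i j => if (i : ℕ) = (j : ℕ) then 1 else 0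
  B := Matrix.of fun i j => if (i : ℕ) = (j : ℕ) + 1 then 1 else 0

/-- The preinjective indecomposable `I n`, with maps `k^{n+1} → k^n`
given by the matrices `(I_n  0)` and `(0  I_n)`. -/
def KRep.Inj (k : Type) [Field k] (n : ℕ) : KRep k where
  d1 := n
  d2 := n + 1
  A := Matrix.of fun i j => if (i : ℕ) = (j : ℕ) then 1 else 0
  B := Matrix.of fun i j => if (i : ℕ) + 1 = (j : ℕ) then 1 else 0

/-- `M` is indecomposable: nonzero, and any decomposition as a direct sum
of two subrepresentations has a zero summand. -/
def KRep.Indecomposable (M : KRep k) : Prop :=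
  0 < M.d1 + M.d2 ∧
    ∀ N₁ N₂ : KRep k, KIso M (N₁.dsum N₂) → N₁.d1 + N₁.d2 = 0 ∨ N₂.d1 + N₂.d2 = 0

/-- The preinjective representation `a 0 · I₀ ⊕ a 1 · I₁ ⊕ ⋯ ⊕ a n · Iₙ`. -/
def KRep.multi (k : Type) [Field k] (a : ℕ → ℕ) (n : ℕ) : KRep k :=
  KRep.dsumList (((List.range (n + 1)).flatMap fun i => List.replicate (a i) (KRep.Inj k i)))

/-- `M'` is a subfactor of `M`: there is a linking module `L` with
`M' ↪ L ↞ M`. -/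
def IsSubfactor (M' M : KRep k) : Prop :=
  ∃ L : KRep k, (∃ f : KHom M' L, f.Mono) ∧ (∃ g : KHom M L, g.Epi)

/-- Auxiliary recursion computing the greedy sequence `b_n, b_{n-1}, …` of the
linking-module multiplicities: `bA a c n k j` is `b_{n-j}`, computed after `k`
steps of the descending recursion (for `j ≤ k`). -/
def bA (a c : ℕ → ℕ) (n : ℕ) : ℕ → ℕ → ℤ
  | 0, _ => min (a n : ℤ) (c n : ℤ)
  | (K + 1), j =>
      if j ≤ K then bA a c n K j
      else
        min
          (Int.fdiv ((∑ i ∈ Finset.Icc (n - (K + 1)) n, (i : ℤ) * a i) -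
              ∑ jj ∈ Finset.range (K + 1), ((n : ℤ) - jj) * bA a c n K jj)
            ((n : ℤ) - (K + 1)))
          (Int.fdiv ((∑ i ∈ Finset.Icc (n - (K + 1)) n, ((i : ℤ) + 1) * c i) -
              ∑ jj ∈ Finset.range (K + 1), ((n : ℤ) - jj + 1) * bA a c n K jj)
            ((n : ℤ) - (K + 1) + 1))

/-- `bfun a c n t = b_t` for `2 ≤ t ≤ n`:  `b_n = min(a_n, c_n)` and
`b_t = ⌊min((Σ_{i=t}^n i·aᵢ − Σ_{i=t+1}^n i·bᵢ)/t,
(Σ_{i=t}^n (i+1)·cᵢ − Σ_{i=t+1}^n (i+1)·bᵢ)/(t+1))⌋`. -/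
def bfun (a c : ℕ → ℕ) (n t : ℕ) : ℤ := bA a c n (n - t) (n - t)

/-- `b₁ = Σ_{i=1}^n i·aᵢ − Σ_{i=2}^n i·bᵢ`. -/
def bone (a c : ℕ → ℕ) (n : ℕ) : ℤ :=
  (∑ i ∈ Finset.Icc 1 n, (i : ℤ) * a i) - ∑ i ∈ Finset.Icc 2 n, (i : ℤ) * bfun a c n i

/-- `b₀ = Σ_{i=0}^n (i+1)·cᵢ − Σ_{i=1}^n (i+1)·bᵢ`. -/
def bzero (a c : ℕ → ℕ) (n : ℕ) : ℤ :=
  (∑ i ∈ Finset.Icc 0 n, ((i : ℤ) + 1) * c i) -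
    (2 * bone a c n + ∑ i ∈ Finset.Icc 2 n, ((i : ℤ) + 1) * bfun a c n i)

/-- The full sequence `b₀, b₁, …, bₙ`. -/
def bfull (a c : ℕ → ℕ) (n t : ℕ) : ℤ :=
  if t = 0 then bzero a c n else if t = 1 then bone a c n else bfun a c n t

/-- A partial sum over `[t, n]` splits off its lowest term. -/
lemma sum_Icc_eq_add_sum_Icc_succ (f : ℕ → ℤ) {t n : ℕ} (h : t ≤ n) :
    ∑ i ∈ Icc t n, f i = f t + ∑ i ∈ Icc (t + 1) n, f i := by
  rw [← Finset.insert_Icc_add_one_left_eq_Icc h, Finset.sum_insert (by simp)]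

lemma bA_eq_of_le (a c : ℕ → ℕ) (n : ℕ) {K j : ℕ} (h : j ≤ K) :
    bA a c n K j = bA a c n j j := by
  induction K with
  | zero => obtain rfl : j = 0 := by omega
            rfl
  | succ K ih =>
    rcases Nat.lt_or_ge K j with hj | hj
    · obtain rfl : j = K + 1 := by omega
      rfl
    · rw [← ih hj, bA, if_pos hj]

lemma sum_range_bA (a c : ℕ → ℕ) {n t : ℕ} (ht : t < n) (w : ℤ) :
    ∑ jj ∈ Finset.range (n - t), ((n : ℤ) - jj + w) * bA a c n (n - t - 1) jj =
      ∑ i ∈ Icc (t + 1) n, ((i : ℤ) + w) * bfun a c n i := by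
  refine Finset.sum_bij' (fun jj _ => n - jj) (fun i _ => n - i) ?_ ?_ ?_ ?_ ?_
  · intro j hj; simp at hj ⊢; omega
  · intro j hj; simp at hj ⊢; omega
  · intro j hj; simp at hj; omega
  · intro j hj; simp at hj; omega
  · intro j hj
    simp at hj
    rw [bfun, bA_eq_of_le a c n (by omega : j ≤ n - t - 1), show n - (n - j) = j by omega,
      Nat.cast_sub (by omega)]

lemma bfun_self (a c : ℕ → ℕ) (n : ℕ) : bfun a c n n = min (a n : ℤ) (c n : ℤ) := by
  simp [bfun, bA]

lemma bfun_of_lt (a c : ℕ → ℕ) {n t : ℕ} (ht : t < n) :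
    bfun a c n t = min
      (Int.fdiv ((∑ i ∈ Icc t n, (i : ℤ) * a i) - ∑ i ∈ Icc (t + 1) n, (i : ℤ) * bfun a c n i) t)
      (Int.fdiv ((∑ i ∈ Icc t n, ((i : ℤ) + 1) * c i) -
        ∑ i ∈ Icc (t + 1) n, ((i : ℤ) + 1) * bfun a c n i) (t + 1)) := by
  have h0 := sum_range_bA a c ht 0
  have h1 := sum_range_bA a c ht 1
  obtain ⟨K, hK⟩ : ∃ K, n - t = K + 1 := ⟨n - t - 1, by omega⟩
  have e : (n : ℤ) - (K + 1) = t := by omega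
  simp only [add_zero, hK, Nat.add_sub_cancel] at h0 h1
  rw [bfun, hK, bA, if_neg (by omega), h0, h1, e, show n - (K + 1) = t by omega]

/-- The defining property of the greedy sequence: `b_t` respects both budgets, and one of
the budgets does not allow `b_t + 1`. -/
lemma bfun_spec (a c : ℕ → ℕ) {n t : ℕ} (ht : 1 ≤ t) (htn : t ≤ n) :
    (∑ i ∈ Icc t n, (i : ℤ) * bfun a c n i ≤ ∑ i ∈ Icc t n, (i : ℤ) * a i) ∧
    (∑ i ∈ Icc t n, ((i : ℤ) + 1) * bfun a c n i ≤ ∑ i ∈ Icc t n, ((i : ℤ) + 1) * c i) ∧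
    ((∑ i ∈ Icc t n, (i : ℤ) * a i < ∑ i ∈ Icc t n, (i : ℤ) * bfun a c n i + t) ∨
      (∑ i ∈ Icc t n, ((i : ℤ) + 1) * c i <
        ∑ i ∈ Icc t n, ((i : ℤ) + 1) * bfun a c n i + (t + 1))) := by
  rw [sum_Icc_eq_add_sum_Icc_succ (fun i => (i : ℤ) * bfun a c n i) htn,
    sum_Icc_eq_add_sum_Icc_succ (fun i => ((i : ℤ) + 1) * bfun a c n i) htn]
  have htz : (1 : ℤ) ≤ t := by exact_mod_cast ht
  rcases htn.lt_or_eq with h | rfl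
  · rw [bfun_of_lt a c h]
    set x := (∑ i ∈ Icc t n, (i : ℤ) * a i) - ∑ i ∈ Icc (t + 1) n, (i : ℤ) * bfun a c n i
      with hx
    set y := (∑ i ∈ Icc t n, ((i : ℤ) + 1) * c i) -
        ∑ i ∈ Icc (t + 1) n, ((i : ℤ) + 1) * bfun a c n i with hy
    rw [Int.fdiv_eq_ediv_of_nonneg _ (by omega), Int.fdiv_eq_ediv_of_nonneg _ (by omega)]
    have hx1 := Int.ediv_mul_le x (by omega : (t : ℤ) ≠ 0)
    have hy1 := Int.ediv_mul_le y (by omega : (t + 1 : ℤ) ≠ 0)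
    have hx2 := Int.lt_ediv_add_one_mul_self x (by omega : (0 : ℤ) < t)
    have hy2 := Int.lt_ediv_add_one_mul_self y (by omega : (0 : ℤ) < t + 1)
    have m1 := mul_le_mul_of_nonneg_left (min_le_left (x / t) (y / (t + 1)))
      (by omega : (0 : ℤ) ≤ t)
    have m2 := mul_le_mul_of_nonneg_left (min_le_right (x / t) (y / (t + 1)))
      (by omega : (0 : ℤ) ≤ t + 1)
    refine ⟨by linarith, by linarith, ?_⟩
    rcases min_choice (x / t) (y / (t + 1)) with e | e <;> rw [e]
    · left; linarith
    · right; linarith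
  · rw [bfun_self]
    have m1 := mul_le_mul_of_nonneg_left (min_le_left (a t : ℤ) (c t))
      (by omega : (0 : ℤ) ≤ t)
    have m2 := mul_le_mul_of_nonneg_left (min_le_right (a t : ℤ) (c t))
      (by omega : (0 : ℤ) ≤ t + 1)
    simp only [Icc_self, sum_singleton, Nat.lt_succ_self, Icc_eq_empty_of_lt, sum_empty, add_zero]
    refine ⟨m1, m2, ?_⟩
    rcases min_choice (a t : ℤ) (c t) with e | e <;> rw [e]
    · left; omega
    · right; omega

lemma bfun_nonneg (a c : ℕ → ℕ) {n t : ℕ} (ht : 1 ≤ t) (htn : t ≤ n) :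
    0 ≤ bfun a c n t := by
  rcases htn.lt_or_eq with h | rfl
  · have hs := bfun_spec a c (show 1 ≤ t + 1 by omega) (show t + 1 ≤ n from h)
    rw [bfun_of_lt a c h, sum_Icc_eq_add_sum_Icc_succ (fun i => (i : ℤ) * a i) htn,
      sum_Icc_eq_add_sum_Icc_succ (fun i => ((i : ℤ) + 1) * c i) htn]
    have h1 : (0 : ℤ) ≤ t * a t := by positivity
    have h2 : (0 : ℤ) ≤ (t + 1) * c t := by positivity
    refine le_min ?_ ?_ <;> refine Int.fdiv_nonneg ?_ (by omega)
    · linarith [hs.1]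
    · linarith [hs.2.1]
  · rw [bfun_self]; positivity

/-- Optimality of the greedy sequence against any sequence `h` (playing the role of
`∑ i, (i - t)⁺ * l i`) whose induced partial sums respect both budgets. -/
lemma greedy_optimal (a c : ℕ → ℕ) {n : ℕ} (h : ℕ → ℤ) (h_top : h (n + 1) = 0)
    (hC : ∀ t, 2 ≤ t → t ≤ n →
      (t + 1) * h t - t * h (t + 1) ≤ ∑ i ∈ Icc t n, ((i : ℤ) + 1) * c i)
    (hA : ∀ t, 2 ≤ t → t ≤ n →
      t * h t - (t - 1) * h (t + 1) ≤ ∑ i ∈ Icc t n, (i : ℤ) * a i)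
    {t : ℕ} (ht : 2 ≤ t) (htn : t ≤ n + 1) :
    h t ≤ ∑ i ∈ Icc t n, ((i : ℤ) - (t - 1)) * bfun a c n i := by
  induction htn using Nat.decreasingInduction with
  | self => simp [h_top]
  | of_succ t htn ih =>
    have hlt : t ≤ n := by omega
    have ih := ih (by omega)
    have key : ∀ w : ℤ, ∑ i ∈ Icc t n, ((i : ℤ) - w) * bfun a c n i =
        ∑ i ∈ Icc t n, (i : ℤ) * bfun a c n i - w * ∑ i ∈ Icc t n, bfun a c n i := by
      intro w
      rw [Finset.mul_sum, ← Finset.sum_sub_distrib]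
      exact Finset.sum_congr rfl fun i _ => by ring
    have kw := key (-1)
    simp only [sub_neg_eq_add, neg_mul, one_mul] at kw
    have kt := key t
    rw [sum_Icc_eq_add_sum_Icc_succ (fun i => ((i : ℤ) - t) * bfun a c n i) hlt, sub_self,
      zero_mul, zero_add] at kt
    push_cast at ih
    rw [add_sub_cancel_right, kt] at ih
    obtain ⟨-, -, hb⟩ := bfun_spec a c (show 1 ≤ t by omega) hlt
    have hC := hC t ht hlt
    have hA := hA t ht hlt
    rw [kw] at hb
    rw [key]
    set G := ∑ i ∈ Icc t n, (i : ℤ) * bfun a c n i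
    set N := ∑ i ∈ Icc t n, bfun a c n i
    have htz : (2 : ℤ) ≤ t := by exact_mod_cast ht
    rcases le_or_gt (h t - h (t + 1)) N with hN | hN
    · linarith
    · have hm := mul_le_mul_of_nonneg_left (Int.add_one_le_iff.mpr hN)
        (by omega : (0 : ℤ) ≤ t - 1)
      rcases hb with hb | hb
      · nlinarith
      · nlinarith

section Shift

variable {E : Type} [AddCommGroup E] [Module k E]

/-- The elements of `D` whose first `j` shifts under `X` stay in `D`. -/
def shiftCore (X : E →ₗ[k] E) (D : Submodule k E) : ℕ → Submodule k E
  | 0 => D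
  | j + 1 => shiftCore X D j ⊓ (shiftCore X D j).comap X

/-- The span of the first `m` shifts of `T` under `X`. -/
def shiftSpan (X : E →ₗ[k] E) (T : Submodule k E) : ℕ → Submodule k E
  | 0 => T
  | m + 1 => T ⊔ (shiftSpan X T m).map X

lemma shiftCore_le (X : E →ₗ[k] E) (D : Submodule k E) (j : ℕ) : shiftCore X D j ≤ D := by
  induction j with
  | zero => exact le_rfl
  | succ j ih => exact inf_le_left.trans ih

lemma shiftCore_map_le (X : E →ₗ[k] E) (D : Submodule k E) (j : ℕ) :
    (shiftCore X D (j + 1)).map X ≤ shiftCore X D j := by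
  rw [Submodule.map_le_iff_le_comap]; exact inf_le_right

lemma mem_shiftCore_succ {X : E →ₗ[k] E} {D : Submodule k E} {j : ℕ} {z : E} (hz : z ∈ D)
    (hXz : X z ∈ shiftCore X D j) : z ∈ shiftCore X D (j + 1) := by
  induction j with
  | zero => exact ⟨hz, hXz⟩
  | succ j ih => exact ⟨ih hXz.1, hXz⟩

lemma shiftSpan_shiftCore_le (X : E →ₗ[k] E) (D : Submodule k E) (m j : ℕ) :
    shiftSpan X (shiftCore X D (m + j)) m ≤ shiftCore X D j := by
  induction m generalizing j with
  | zero => rw [Nat.zero_add]; exact le_rfl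
  | succ m ih =>
    refine sup_le ?_ ?_
    · clear ih
      induction m with
      | zero => rw [Nat.add_comm]; exact inf_le_left
      | succ m ih => exact (by rw [Nat.add_right_comm]; exact inf_le_left :
          shiftCore X D (m + 1 + 1 + j) ≤ _).trans ih
    · have := ih (j + 1)
      rw [show m + (j + 1) = m + 1 + j by omega] at this
      exact (Submodule.map_mono this).trans (shiftCore_map_le X D j)

lemma shiftSpan_finiteDimensional (X : E →ₗ[k] E) (T : Submodule k E)
    [FiniteDimensional k T] (m : ℕ) : FiniteDimensional k (shiftSpan X T m) := by
  induction m with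
  | zero => assumption
  | succ m ih =>
    change FiniteDimensional k ↥(T ⊔ (shiftSpan X T m).map X)
    infer_instance

lemma shiftCore_finiteDimensional (X : E →ₗ[k] E) (D : Submodule k E)
    [FiniteDimensional k D] (j : ℕ) : FiniteDimensional k (shiftCore X D j) :=
  Submodule.finiteDimensional_of_le (shiftCore_le X D j)

lemma finrank_shiftSpan_succ (X : E →ₗ[k] E) (hX : Function.Injective X) (D : Submodule k E)
    [FiniteDimensional k D] {m j : ℕ} (hm : m ≤ j) :
    Module.finrank k (shiftSpan X (shiftCore X D j) m) + Module.finrank k (shiftCore X D j) ≤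
      Module.finrank k (shiftSpan X (shiftCore X D j) (m + 1)) +
        Module.finrank k (shiftCore X D (j + 1)) := by
  have := shiftCore_finiteDimensional X D j
  have := shiftCore_finiteDimensional X D (j + 1)
  have := shiftSpan_finiteDimensional X (shiftCore X D j) m
  have h := Submodule.finrank_sup_add_finrank_inf_eq (shiftCore X D j)
    ((shiftSpan X (shiftCore X D j) m).map X)
  have e (S : Submodule k E) : Module.finrank k (S.map X) = Module.finrank k S :=
    LinearEquiv.finrank_eq (Submodule.equivMapOfInjective X hX S).symm
  have hle : shiftCore X D j ⊓ (shiftSpan X (shiftCore X D j) m).map X ≤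
      (shiftCore X D (j + 1)).map X := by
    rintro _ ⟨h1, z, hz, rfl⟩
    refine ⟨z, mem_shiftCore_succ ?_ h1, rfl⟩
    have := shiftSpan_shiftCore_le X D m (j - m)
    rw [Nat.add_sub_cancel' hm] at this
    exact shiftCore_le _ _ _ (this hz)
  have h2 := Submodule.finrank_mono hle
  rw [e] at h h2
  have : shiftSpan X (shiftCore X D j) (m + 1) =
    shiftCore X D j ⊔ (shiftSpan X (shiftCore X D j) m).map X := rfl
  rw [this]
  omega

lemma le_finrank_shiftSpan (X : E →ₗ[k] E) (hX : Function.Injective X) (D : Submodule k E)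
    [FiniteDimensional k D] {m j : ℕ} (hm : m ≤ j + 1) :
    ((m : ℤ) + 1) * Module.finrank k (shiftCore X D j) -
        m * Module.finrank k (shiftCore X D (j + 1)) ≤
      Module.finrank k (shiftSpan X (shiftCore X D j) m) := by
  induction m with
  | zero =>
    simp only [Nat.cast_zero, zero_add, one_mul, zero_mul, sub_zero]
    exact le_rfl
  | succ m ih =>
    have h := finrank_shiftSpan_succ X hX D (show m ≤ j by omega)
    have ih := ih (by omega)
    zify at h
    push_cast
    linarith

/-- Multiplication by the variable on families of coefficient sequences. -/
def seqShift (k : Type) [Field k] (R : Type) : (R → ℕ → k) →ₗ[k] (R → ℕ → k) where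
  toFun f r x := if x = 0 then 0 else f r (x - 1)
  map_add' f g := by ext r x; by_cases h : x = 0 <;> simp [h]
  map_smul' a f := by ext r x; by_cases h : x = 0 <;> simp [h]

lemma seqShift_injective (R : Type) : Function.Injective (seqShift k R) := by
  intro f g h
  ext r x
  simpa [seqShift] using congrFun (congrFun h r) (x + 1)

/-- Families of sequences whose `r`-th member vanishes from position `p r` on. -/
def supportedBelow (k : Type) [Field k] {R : Type} (p : R → ℕ) : Submodule k (R → ℕ → k) where
  carrier := {f | ∀ r x, p r ≤ x → f r x = 0}
  zero_mem' := by intro r x _; rfl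
  add_mem' := by intro f g hf hg r x h; simp [hf r x h, hg r x h]
  smul_mem' := by intro a f hf r x h; simp [hf r x h]

lemma shiftCore_support {R : Type} {p : R → ℕ} {D : Submodule k (R → ℕ → k)}
    (hD : D ≤ supportedBelow k p) (j : ℕ) {f : R → ℕ → k}
    (hf : f ∈ shiftCore (seqShift k R) D j) {r : R} {x : ℕ} (h : f r x ≠ 0) : x + j < p r := by
  induction j generalizing x f with
  | zero => by_contra hx; exact h (hD hf r x (by omega))
  | succ j ih =>
    have := ih hf.2 (x := x + 1) (by simpa [seqShift] using h)
    omega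

lemma shiftSpan_support {R : Type} {p : R → ℕ} {D : Submodule k (R → ℕ → k)}
    (hD : D ≤ supportedBelow k p) (m j : ℕ) {f : R → ℕ → k}
    (hf : f ∈ shiftSpan (seqShift k R) (shiftCore (seqShift k R) D j) m) {r : R} {x : ℕ}
    (h : f r x ≠ 0) : x + j < p r + m ∧ j < p r := by
  induction m generalizing x f with
  | zero =>
    have := shiftCore_support hD j hf h
    omega
  | succ m ih =>
    obtain ⟨u, hu, _, ⟨v, hv, rfl⟩, rfl⟩ := Submodule.mem_sup.mp hf
    by_cases hu0 : u r x = 0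
    · have hx : x ≠ 0 ∧ v r (x - 1) ≠ 0 := by
        by_contra hc
        apply h
        by_cases h0 : x = 0
        · subst h0; simpa [seqShift] using hu0
        · simpa [seqShift, hu0, h0] using hc
      have := ih hv hx.2
      omega
    · have := shiftCore_support hD j hu hu0
      omega

/-- A space of families of sequences which is determined by finitely many coordinates has
dimension at most their number. -/
lemma finrank_le_card_of_coords {R : Type} (Z : Submodule k (R → ℕ → k)) {ι : Type} [Fintype ι]
    (q : ι → R × ℕ) (h : ∀ z ∈ Z, (∀ i, z (q i).1 (q i).2 = 0) → z = 0) :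
    Module.finrank k Z ≤ Fintype.card ι := by
  let φ : Z →ₗ[k] (ι → k) :=
    { toFun := fun z i => z.1 (q i).1 (q i).2
      map_add' := by intros; rfl
      map_smul' := by intros; rfl }
  have hφ : Function.Injective φ := by
    rw [← LinearMap.ker_eq_bot, LinearMap.ker_eq_bot']
    intro z hz
    exact Subtype.ext (h z z.2 fun i => congrFun hz i)
  simpa using LinearMap.finrank_le_finrank_of_injective hφ

end Shift

section Model

/-- Coordinates identifying `M` with the direct sum of the `I_{p r}`, `r : R`. -/
structure KModel (M : KRep k) {R : Type} [DecidableEq R] (p : R → ℕ) where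
  e1 : Fin M.d1 ≃ Σ r, Fin (p r)
  e2 : Fin M.d2 ≃ Σ r, Fin (p r + 1)
  hA : ∀ x y, M.A (e1.symm x) (e2.symm y) = if x.1 = y.1 ∧ (x.2 : ℕ) = y.2 then 1 else 0
  hB : ∀ x y, M.B (e1.symm x) (e2.symm y) = if x.1 = y.1 ∧ (x.2 : ℕ) + 1 = y.2 then 1 else 0

def KModel.zero : KModel (KRep.zero : KRep k) (fun r : Empty => r.elim) where
  e1 := Equiv.equivOfIsEmpty (Fin 0) _
  e2 := Equiv.equivOfIsEmpty (Fin 0) _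
  hA x := x.1.elim
  hB x := x.1.elim

def KModel.inj (i : ℕ) : KModel (KRep.Inj k i) (fun _ : Unit => i) where
  e1 := (Equiv.uniqueSigma fun _ : Unit => Fin i).symm
  e2 := (Equiv.uniqueSigma fun _ : Unit => Fin (i + 1)).symm
  hA x y := by
    obtain ⟨⟨⟩, x⟩ := x
    obtain ⟨⟨⟩, y⟩ := y
    change (KRep.Inj k i).A x y = _
    simp [KRep.Inj]
  hB x y := by
    obtain ⟨⟨⟩, x⟩ := x
    obtain ⟨⟨⟩, y⟩ := y
    change (KRep.Inj k i).B x y = _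
    simp [KRep.Inj]

def KModel.dsum {M N : KRep k} {R S : Type} [DecidableEq R] [DecidableEq S] {p : R → ℕ}
    {q : S → ℕ} (m : KModel M p) (m' : KModel N q) : KModel (M.dsum N) (Sum.elim p q) where
  e1 := finSumFinEquiv.symm.trans ((Equiv.sumCongr m.e1 m'.e1).trans
    (Equiv.sumSigmaDistrib fun r => Fin (Sum.elim p q r)).symm)
  e2 := finSumFinEquiv.symm.trans ((Equiv.sumCongr m.e2 m'.e2).trans
    (Equiv.sumSigmaDistrib fun r => Fin (Sum.elim p q r + 1)).symm)
  hA x y := by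
    rcases x with ⟨r | r, x⟩ <;> rcases y with ⟨s | s, y⟩
    · change fromBlocks M.A 0 0 N.A
        (finSumFinEquiv.symm (finSumFinEquiv (Sum.inl (m.e1.symm ⟨r, x⟩))))
        (finSumFinEquiv.symm (finSumFinEquiv (Sum.inl (m.e2.symm ⟨s, y⟩)))) = _
      simp [m.hA]
    · change fromBlocks M.A 0 0 N.A
        (finSumFinEquiv.symm (finSumFinEquiv (Sum.inl (m.e1.symm ⟨r, x⟩))))
        (finSumFinEquiv.symm (finSumFinEquiv (Sum.inr (m'.e2.symm ⟨s, y⟩)))) = _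
      simp
    · change fromBlocks M.A 0 0 N.A
        (finSumFinEquiv.symm (finSumFinEquiv (Sum.inr (m'.e1.symm ⟨r, x⟩))))
        (finSumFinEquiv.symm (finSumFinEquiv (Sum.inl (m.e2.symm ⟨s, y⟩)))) = _
      simp
    · change fromBlocks M.A 0 0 N.A
        (finSumFinEquiv.symm (finSumFinEquiv (Sum.inr (m'.e1.symm ⟨r, x⟩))))
        (finSumFinEquiv.symm (finSumFinEquiv (Sum.inr (m'.e2.symm ⟨s, y⟩)))) = _
      simp [m'.hA]
  hB x y := by
    rcases x with ⟨r | r, x⟩ <;> rcases y with ⟨s | s, y⟩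
    · change fromBlocks M.B 0 0 N.B
        (finSumFinEquiv.symm (finSumFinEquiv (Sum.inl (m.e1.symm ⟨r, x⟩))))
        (finSumFinEquiv.symm (finSumFinEquiv (Sum.inl (m.e2.symm ⟨s, y⟩)))) = _
      simp [m.hB]
    · change fromBlocks M.B 0 0 N.B
        (finSumFinEquiv.symm (finSumFinEquiv (Sum.inl (m.e1.symm ⟨r, x⟩))))
        (finSumFinEquiv.symm (finSumFinEquiv (Sum.inr (m'.e2.symm ⟨s, y⟩)))) = _
      simp
    · change fromBlocks M.B 0 0 N.B
        (finSumFinEquiv.symm (finSumFinEquiv (Sum.inr (m'.e1.symm ⟨r, x⟩))))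
        (finSumFinEquiv.symm (finSumFinEquiv (Sum.inl (m.e2.symm ⟨s, y⟩)))) = _
      simp
    · change fromBlocks M.B 0 0 N.B
        (finSumFinEquiv.symm (finSumFinEquiv (Sum.inr (m'.e1.symm ⟨r, x⟩))))
        (finSumFinEquiv.symm (finSumFinEquiv (Sum.inr (m'.e2.symm ⟨s, y⟩)))) = _
      simp [m'.hB]

lemma exists_model_dsumList (l : List ℕ) :
    ∃ (R : Type) (_ : Fintype R) (_ : DecidableEq R) (p : R → ℕ),
      Nonempty (KModel (KRep.dsumList (l.map (KRep.Inj k))) p) ∧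
        ∀ f : ℕ → ℕ, ∑ r, f (p r) = (l.map f).sum := by
  induction l with
  | nil => exact ⟨Empty, inferInstance, inferInstance, _, ⟨KModel.zero⟩, by simp⟩
  | cons i l ih =>
    obtain ⟨R, _, _, p, ⟨m⟩, hp⟩ := ih
    exact ⟨Unit ⊕ R, inferInstance, inferInstance, _, ⟨(KModel.inj i).dsum m⟩, by simp [hp]⟩

lemma exists_model_multi (k : Type) [Field k] (a : ℕ → ℕ) (n : ℕ) :
    ∃ (R : Type) (_ : Fintype R) (_ : DecidableEq R) (p : R → ℕ),
      Nonempty (KModel (KRep.multi k a n) p) ∧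
        ∀ f : ℕ → ℕ, ∑ r, f (p r) = ∑ i ∈ range (n + 1), a i * f i := by
  obtain ⟨R, hR, hR', p, m, hp⟩ := exists_model_dsumList (k := k)
    ((List.range (n + 1)).flatMap fun i => List.replicate (a i) i)
  have e : KRep.multi k a n = KRep.dsumList
      (((List.range (n + 1)).flatMap fun i => List.replicate (a i) i).map (KRep.Inj k)) := by
    simp [KRep.multi, List.map_flatMap]
  rw [← e] at m
  refine ⟨R, hR, hR', p, m, fun f => ?_⟩
  rw [hp]
  generalize n + 1 = N
  induction N with
  | zero => simp
  | succ N ih => simp [List.range_succ, Finset.sum_range_succ, ← ih]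

variable {M : KRep k} {R : Type} [DecidableEq R] {p : R → ℕ}

/-- A row vector on the sink of `M`, as a family of sequences. -/
def KModel.row1 (m : KModel M p) : (Fin M.d1 → k) →ₗ[k] (R → ℕ → k) where
  toFun φ r x := if h : x < p r then φ (m.e1.symm ⟨r, x, h⟩) else 0
  map_add' f g := by ext r x; by_cases h : x < p r <;> simp [h]
  map_smul' a f := by ext r x; by_cases h : x < p r <;> simp [h]

/-- A row vector on the source of `M`, as a family of sequences. -/
def KModel.row2 (m : KModel M p) : (Fin M.d2 → k) →ₗ[k] (R → ℕ → k) where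
  toFun φ r x := if h : x ≤ p r then φ (m.e2.symm ⟨r, x, Nat.lt_succ_of_le h⟩) else 0
  map_add' f g := by ext r x; by_cases h : x ≤ p r <;> simp [h]
  map_smul' a f := by ext r x; by_cases h : x ≤ p r <;> simp [h]

lemma KModel.row1_apply (m : KModel M p) (φ : Fin M.d1 → k) (r : R) (x : ℕ) :
    m.row1 φ r x = if h : x < p r then φ (m.e1.symm ⟨r, x, h⟩) else 0 := rfl

lemma KModel.row2_apply (m : KModel M p) (φ : Fin M.d2 → k) (r : R) (x : ℕ) :
    m.row2 φ r x = if h : x ≤ p r then φ (m.e2.symm ⟨r, x, Nat.lt_succ_of_le h⟩) else 0 := rfl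

lemma KModel.row1_apply_e1 (m : KModel M p) (φ : Fin M.d1 → k) (i : Fin M.d1) :
    m.row1 φ (m.e1 i).1 (m.e1 i).2 = φ i := by
  simp [KModel.row1_apply]

lemma KModel.row2_apply_e2 (m : KModel M p) (φ : Fin M.d2 → k) (i : Fin M.d2) :
    m.row2 φ (m.e2 i).1 (m.e2 i).2 = φ i := by
  simp [KModel.row2_apply, Nat.le_of_lt_succ (m.e2 i).2.2]

lemma KModel.row1_injective (m : KModel M p) : Function.Injective m.row1 := by
  intro f g h
  ext i
  rw [← m.row1_apply_e1 f, h, m.row1_apply_e1]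

lemma KModel.row2_injective (m : KModel M p) : Function.Injective m.row2 := by
  intro f g h
  ext i
  rw [← m.row2_apply_e2 f, h, m.row2_apply_e2]

lemma KModel.row1_mem (m : KModel M p) (φ : Fin M.d1 → k) : m.row1 φ ∈ supportedBelow k p := by
  intro r x h
  rw [m.row1_apply, dif_neg (by omega)]

variable [Fintype R]

lemma KModel.row2_vecMul_A (m : KModel M p) (φ : Fin M.d1 → k) :
    m.row2 (φ ᵥ* M.A) = m.row1 φ := by
  have key (y : Σ r, Fin (p r + 1)) : (φ ᵥ* M.A) (m.e2.symm y) =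
      ∑ x : Σ r, Fin (p r), if x.1 = y.1 ∧ (x.2 : ℕ) = y.2 then φ (m.e1.symm x) else 0 := by
    change ∑ i, φ i * M.A i (m.e2.symm y) = _
    rw [← m.e1.symm.sum_comp]
    simp only [m.hA, mul_ite, mul_one, mul_zero]
  ext r x
  rw [m.row1_apply, m.row2_apply]
  split_ifs with h1 h2 h2
  · rw [key, Finset.sum_eq_single ⟨r, x, h2⟩]
    · simp
    · rintro ⟨r', x', hx'⟩ - hne
      rw [if_neg]
      rintro ⟨rfl, rfl⟩
      exact hne rfl
    · simp
  · rw [key]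
    refine Finset.sum_eq_zero fun y _ => if_neg ?_
    rintro ⟨rfl, h4⟩
    have := y.2.2
    dsimp only at h4 h2
    omega
  · omega
  · rfl

lemma KModel.row2_vecMul_B (m : KModel M p) (φ : Fin M.d1 → k) :
    m.row2 (φ ᵥ* M.B) = seqShift k R (m.row1 φ) := by
  have key (y : Σ r, Fin (p r + 1)) : (φ ᵥ* M.B) (m.e2.symm y) =
      ∑ x : Σ r, Fin (p r), if x.1 = y.1 ∧ (x.2 : ℕ) + 1 = y.2 then φ (m.e1.symm x) else 0 := by
    change ∑ i, φ i * M.B i (m.e2.symm y) = _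
    rw [← m.e1.symm.sum_comp]
    simp only [m.hB, mul_ite, mul_one, mul_zero]
  ext r x
  change _ = if x = 0 then 0 else m.row1 φ r (x - 1)
  rw [m.row1_apply, m.row2_apply]
  by_cases h : x ≠ 0 ∧ x - 1 < p r
  · rw [dif_pos (by omega), if_neg h.1, dif_pos h.2, key, Finset.sum_eq_single ⟨r, x - 1, h.2⟩]
    · rw [if_pos]
      simp
      omega
    · rintro ⟨r', x', hx'⟩ - hne
      rw [if_neg]
      rintro ⟨rfl, h4⟩
      obtain rfl : x = x' + 1 := h4.symm
      exact hne rfl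
    · simp
  · have hz : ∀ hx : x < p r + 1, (φ ᵥ* M.B) (m.e2.symm ⟨r, x, hx⟩) = 0 := by
      intro hx
      rw [key]
      refine Finset.sum_eq_zero fun y _ => if_neg ?_
      rintro ⟨rfl, h4⟩
      have := y.2.2
      dsimp only at h4
      omega
    split_ifs <;> first | rfl | omega | exact hz _

end Model

section Necessity

variable {M M' L : KRep k} {R S : Type} [DecidableEq R] [DecidableEq S] {p : R → ℕ} {q : S → ℕ}

lemma vecMul_injective_of_mulVecLin_surjective {m n : ℕ} {A : Matrix (Fin m) (Fin n) k}
    (hA : Function.Surjective A.mulVecLin) {v : Fin m → k} (hv : v ᵥ* A = 0) : v = 0 := by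
  obtain ⟨B, hB⟩ := Matrix.mulVec_surjective_iff_exists_right_inverse.mp hA
  rw [← Matrix.vecMul_one v, ← hB, ← Matrix.vecMul_vecMul, hv, Matrix.zero_vecMul]

lemma vecMulLinear_surjective_of_mulVecLin_injective {m n : ℕ} {A : Matrix (Fin m) (Fin n) k}
    (hA : Function.Injective A.mulVecLin) : Function.Surjective A.vecMulLinear := by
  obtain ⟨φ, hφ⟩ := LinearMap.exists_leftInverse_of_injective _ (LinearMap.ker_eq_bot.mpr hA)
  have hB : LinearMap.toMatrix' φ * A = 1 := by
    rw [← LinearMap.toMatrix'_id, ← hφ, LinearMap.toMatrix'_comp, ← Matrix.toLin'_apply',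
      LinearMap.toMatrix'_toLin']
  intro w
  exact ⟨w ᵥ* LinearMap.toMatrix' φ, by simp [hB]⟩

/-- Row vectors on the sink of `L`, pulled back along `g : M → L` and `f : M' → L`. -/
def pull1 (m : KModel M p) (m' : KModel M' q) (g : KHom M L) (f : KHom M' L) :
    (Fin L.d1 → k) →ₗ[k] (R ⊕ S → ℕ → k) where
  toFun ψ := Sum.elim (m.row1 (ψ ᵥ* g.f1)) (m'.row1 (ψ ᵥ* f.f1))
  map_add' u v := by ext (r | s) x <;> simp [Matrix.add_vecMul]
  map_smul' c u := by ext (r | s) x <;> simp [Matrix.smul_vecMul]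

/-- Row vectors on the source of `L`, pulled back along `g : M → L` and `f : M' → L`. -/
def pull2 (m : KModel M p) (m' : KModel M' q) (g : KHom M L) (f : KHom M' L) :
    (Fin L.d2 → k) →ₗ[k] (R ⊕ S → ℕ → k) where
  toFun ψ := Sum.elim (m.row2 (ψ ᵥ* g.f2)) (m'.row2 (ψ ᵥ* f.f2))
  map_add' u v := by ext (r | s) x <;> simp [Matrix.add_vecMul]
  map_smul' c u := by ext (r | s) x <;> simp [Matrix.smul_vecMul]

lemma pull1_mem (m : KModel M p) (m' : KModel M' q) (g : KHom M L) (f : KHom M' L)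
    (ψ : Fin L.d1 → k) : pull1 m m' g f ψ ∈ supportedBelow k (Sum.elim p q) := by
  rintro (r | s) x h
  · exact m.row1_mem _ r x h
  · exact m'.row1_mem _ s x h

lemma card_sigma_subtype {R : Type} [Fintype R] (P : R → Prop) [DecidablePred P] (w : R → ℕ) :
    Fintype.card (Σ r : {r // P r}, Fin (w r)) = ∑ r, if P r then w r else 0 := by
  rw [Fintype.card_sigma, ← Finset.sum_filter]
  simp only [Fintype.card_fin]
  exact (Finset.sum_subtype _ (by simp) w).symm

variable [Fintype R] [Fintype S]

lemma pull2_vecMul_A (m : KModel M p) (m' : KModel M' q) (g : KHom M L) (f : KHom M' L)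
    (ψ : Fin L.d1 → k) : pull2 m m' g f (ψ ᵥ* L.A) = pull1 m m' g f ψ := by
  change Sum.elim _ _ = Sum.elim _ _
  rw [Matrix.vecMul_vecMul, Matrix.vecMul_vecMul, ← g.comm_a, ← f.comm_a,
    ← Matrix.vecMul_vecMul, ← Matrix.vecMul_vecMul, m.row2_vecMul_A, m'.row2_vecMul_A]

lemma pull2_vecMul_B (m : KModel M p) (m' : KModel M' q) (g : KHom M L) (f : KHom M' L)
    (ψ : Fin L.d1 → k) :
    pull2 m m' g f (ψ ᵥ* L.B) = seqShift k (R ⊕ S) (pull1 m m' g f ψ) := by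
  change Sum.elim (m.row2 _) (m'.row2 _) = _
  rw [Matrix.vecMul_vecMul, Matrix.vecMul_vecMul, ← g.comm_b, ← f.comm_b,
    ← Matrix.vecMul_vecMul, ← Matrix.vecMul_vecMul, m.row2_vecMul_B, m'.row2_vecMul_B]
  ext (r | s) x <;> rfl

/-- Numerical constraints imposed by a linking module `M' ↪ L ↞ M`: `h j` is the dimension of
the space of homomorphisms to `I_{j+1}` from the quotient of `L` with sink that of `M'`. -/
lemma exists_hom_dims_of_mono_of_epi (m : KModel M p) (m' : KModel M' q) (g : KHom M L)
    (f : KHom M' L) (hg : g.Epi) (hf : f.Mono) :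
    ∃ h : ℕ → ℕ, h 0 = ∑ s, q s ∧ (∀ j, (∀ r, p r ≤ j) → h j = 0) ∧
      (∀ j : ℕ, ((j : ℤ) + 2) * h j - (j + 1) * h (j + 1) ≤
        (∑ r, if j < p r then p r + 1 else 0 : ℕ)) ∧
      (∀ j : ℕ, ((j : ℤ) + 1) * h j - j * h (j + 1) ≤ (∑ s, if j < q s then q s else 0 : ℕ)) ∧
      2 * (h 0 : ℤ) - h 1 + (∑ s, if q s = 0 then 1 else 0 : ℕ) ≤ (∑ r, (p r + 1) : ℕ) := by
  set X := seqShift k (R ⊕ S)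
  have hX : Function.Injective X := seqShift_injective _
  obtain ⟨K, hK⟩ := Submodule.exists_isCompl (LinearMap.ker f.f1.vecMulLinear)
  set D := K.map (pull1 m m' g f) with hD
  have hDsup : D ≤ supportedBelow k (Sum.elim p q) := by
    rintro _ ⟨ψ, -, rfl⟩; exact pull1_mem m m' g f ψ
  have inj1 : ∀ ψ ∈ K, m'.row1 (ψ ᵥ* f.f1) = 0 → ψ = 0 := by
    intro ψ hψ h
    have h0 : ψ ᵥ* f.f1 = 0 := m'.row1_injective (by rw [h, map_zero])
    have : ψ ∈ LinearMap.ker f.f1.vecMulLinear ⊓ K := ⟨h0, hψ⟩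
    simpa [hK.inf_eq_bot] using this
  have inj2 : ∀ φ, m.row2 (φ ᵥ* g.f2) = 0 → φ = 0 := by
    intro φ h
    have h0 : φ ᵥ* g.f2 = 0 := m.row2_injective (by rw [h, map_zero])
    exact vecMul_injective_of_mulVecLin_surjective hg.2 h0
  have hDrange : D ⊔ D.map X ≤ LinearMap.range (pull2 m m' g f) := by
    refine sup_le ?_ ?_
    · rintro _ ⟨ψ, -, rfl⟩
      exact ⟨_, pull2_vecMul_A m m' g f ψ⟩
    · rintro _ ⟨_, ⟨ψ, -, rfl⟩, rfl⟩
      exact ⟨_, pull2_vecMul_B m m' g f ψ⟩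
  have hZD : ∀ j, shiftSpan X (shiftCore X D j) j ≤ D := fun j => shiftSpan_shiftCore_le X D j 0
  have hZ2 : ∀ j, shiftSpan X (shiftCore X D j) (j + 1) ≤ LinearMap.range (pull2 m m' g f) :=
    fun j => (sup_le_sup (shiftCore_le X D j) (Submodule.map_mono (hZD j))).trans hDrange
  have hrank : Module.finrank k D = ∑ s, q s := by
    have e1 : Module.finrank k D = Module.finrank k K := by
      have hinj : Function.Injective ((pull1 m m' g f).domRestrict K) := by
        rw [← LinearMap.ker_eq_bot, LinearMap.ker_eq_bot']
        intro ψ hψ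
        refine Subtype.ext (inj1 ψ ψ.2 ?_)
        ext s x
        exact congrFun (congrFun hψ (Sum.inr s)) x
      rw [hD, ← LinearMap.range_domRestrict]
      exact (LinearEquiv.ofInjective _ hinj).finrank_eq.symm
    have e2 := (K.quotientEquivOfIsCompl (LinearMap.ker f.f1.vecMulLinear) hK.symm).finrank_eq
    have e3 := Submodule.finrank_add_eq_of_isCompl hK
    have e4 := LinearMap.finrank_range_add_finrank_ker f.f1.vecMulLinear
    rw [LinearMap.range_eq_top.mpr (vecMulLinear_surjective_of_mulVecLin_injective hf.1),
      finrank_top] at e4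
    have e5 := Fintype.card_congr m'.e1
    simp only [Module.finrank_fin_fun, Fintype.card_sigma, Fintype.card_fin] at e3 e4 e5
    omega
  refine ⟨fun j => Module.finrank k (shiftCore X D j), hrank, ?_, ?_, ?_, ?_⟩
  · intro j hj
    have : shiftCore X D j = ⊥ := by
      rw [eq_bot_iff]
      intro z hz
      obtain ⟨ψ, hψ⟩ := hDrange (Submodule.mem_sup_left (shiftCore_le X D j hz))
      rw [Submodule.mem_bot, ← hψ, inj2 ψ, map_zero]
      ext r x
      by_contra hne
      have hne : z (Sum.inl r) x ≠ 0 := by rw [← hψ]; exact hne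
      have := shiftCore_support hDsup j hz hne
      have := hj r
      simp only [Sum.elim_inl] at *
      omega
    change Module.finrank k (shiftCore X D j) = 0
    rw [this, finrank_bot]
  · intro j
    have h1 := le_finrank_shiftSpan X hX D (le_refl (j + 1))
    have h2 := finrank_le_card_of_coords (shiftSpan X (shiftCore X D j) (j + 1))
      (ι := Σ r : {r // j < p r}, Fin (p r + 1)) (fun i => (Sum.inl i.1, i.2)) (by
        intro z hz h0
        obtain ⟨φ, hφ⟩ := hZ2 j hz
        rw [← hφ, inj2 φ, map_zero]
        ext r x
        by_contra hne
        have hne : z (Sum.inl r) x ≠ 0 := by rw [← hφ]; exact hne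
        have hs := shiftSpan_support hDsup (j + 1) j hz hne
        have hx : x ≤ p r := by
          by_contra hx
          apply hne
          rw [← hφ]
          exact dif_neg hx
        exact hne (h0 ⟨⟨r, hs.2⟩, ⟨x, Nat.lt_succ_of_le hx⟩⟩))
    rw [card_sigma_subtype (fun r => j < p r) (fun r => p r + 1)] at h2
    push_cast at h1
    have h2 := Int.ofNat_le.mpr h2
    linarith
  · intro j
    have h1 := le_finrank_shiftSpan X hX D (Nat.le_succ j)
    have h2 := finrank_le_card_of_coords (shiftSpan X (shiftCore X D j) j)
      (ι := Σ s : {s // j < q s}, Fin (q s)) (fun i => (Sum.inr i.1, i.2)) (by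
        intro z hz h0
        obtain ⟨ψ, hK, hψ⟩ := hZD j hz
        rw [← hψ, inj1 ψ hK, map_zero]
        ext s x
        by_contra hne
        have hne : z (Sum.inr s) x ≠ 0 := by rw [← hψ]; exact hne
        have hs := shiftSpan_support hDsup j j hz hne
        have hx : x < q s := Nat.lt_of_add_lt_add_right hs.1
        exact hne (h0 ⟨⟨s, hs.2⟩, ⟨x, hx⟩⟩))
    rw [card_sigma_subtype (fun s => j < q s) q] at h2
    have h2 := Int.ofNat_le.mpr h2
    linarith
  · have h1 : (((1 : ℕ) : ℤ) + 1) * Module.finrank k (shiftCore X D 0) -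
        ((1 : ℕ) : ℤ) * Module.finrank k (shiftCore X D 1) ≤
          Module.finrank k (shiftSpan X (shiftCore X D 0) 1) :=
      le_finrank_shiftSpan X hX D (le_refl (0 + 1))
    let π : (Fin L.d2 → k) →ₗ[k] ({s // q s = 0} → k) :=
      { toFun := fun φ s => pull2 m m' g f φ (Sum.inr s) 0
        map_add' := by intros; ext; simp
        map_smul' := by intros; ext; simp }
    have hπ : Function.Surjective π := by
      intro w
      obtain ⟨φ, hφ⟩ := vecMulLinear_surjective_of_mulVecLin_injective hf.2
        (fun i => if h : q (m'.e2 i).1 = 0 then w ⟨_, h⟩ else 0)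
      refine ⟨φ, funext fun s => ?_⟩
      change m'.row2 (φ ᵥ* f.f2) s 0 = w s
      rw [Matrix.vecMulLinear_apply] at hφ
      rw [hφ, m'.row2_apply, dif_pos (Nat.zero_le _)]
      simp [s.2]
    have h2 := LinearMap.finrank_range_add_finrank_ker π
    rw [LinearMap.range_eq_top.mpr hπ, finrank_top, Module.finrank_fintype_fun_eq_card,
      Module.finrank_fin_fun, Fintype.card_subtype, Finset.card_filter] at h2
    have h3 : Module.finrank k (shiftSpan X (shiftCore X D 0) 1) ≤
        Module.finrank k (LinearMap.ker π) := by
      have hle : (shiftSpan X (shiftCore X D 0) 1) ≤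
          (LinearMap.ker π).map (pull2 m m' g f) := by
        intro z hz
        obtain ⟨φ, hφ⟩ := hZ2 0 hz
        refine ⟨φ, funext fun s => ?_, hφ⟩
        by_contra hne
        have hne : z (Sum.inr s) 0 ≠ 0 := by rw [← hφ]; exact hne
        have hs := (shiftSpan_support hDsup 1 0 hz hne).2
        simp [s.2] at hs
      exact (Submodule.finrank_mono hle).trans (Submodule.finrank_map_le _ _)
    have h4 : L.d2 ≤ M.d2 := by
      simpa using LinearMap.finrank_le_finrank_of_surjective hg.2
    have h5 := Fintype.card_congr m.e2
    simp only [Fintype.card_sigma, Fintype.card_fin] at h5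
    rw [← h5]
    simp only [Nat.cast_one, one_mul] at h1 h3 ⊢
    omega

end Necessity

section Staircase

lemma linearIndependent_of_triangular {J C : Type} [Fintype J] (v : J → C → k) (o : J → C)
    (ρ : J → ℕ) (h0 : ∀ j, v j (o j) ≠ 0) (h1 : ∀ j j', v j (o j') ≠ 0 → j = j' ∨ ρ j < ρ j') :
    LinearIndependent k v := by
  classical
  rw [Fintype.linearIndependent_iff]
  intro w hw
  by_contra! hne
  obtain ⟨j', hj', hmin⟩ := (Finset.univ.filter fun j => w j ≠ 0).exists_min_image ρ
    (by obtain ⟨i, hi⟩ := hne; exact ⟨i, by simpa using hi⟩)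
  simp only [Finset.mem_filter, Finset.mem_univ, true_and] at hj' hmin
  have h2 := congrFun hw (o j')
  rw [Finset.sum_apply, Finset.sum_eq_single j'] at h2
  · exact mul_ne_zero hj' (h0 j') h2
  · intro j _ hj
    by_contra hz
    rcases h1 j j' (right_ne_zero_of_mul hz) with h | h
    · exact hj h
    · exact absurd (hmin j (left_ne_zero_of_mul hz)) (by omega)
  · simp

/-- Placing intervals of lengths `b s` consecutively along consecutive intervals of lengths
`l r`: an interval lying inside one of the latter gives one coefficient, an interval crossing
from `r` to `r + 1` gives the last admissible one of `r` and the first one of `r + 1`. -/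
lemma exists_staircase (l b : ℕ → ℕ) (N : ℕ)
    (H : ∀ s < N, 1 ≤ b s → ∃ t, (∀ r < t, b s ≤ l r) ∧
      ∑ i ∈ range (s + 1), b i ≤ ∑ i ∈ range t, l i) :
    ∃ (G : ℕ → ℕ → ℕ → Prop) (o : ℕ → ℕ → ℕ × ℕ) (ρ : ℕ → ℕ → ℕ),
      (∀ s < N, ∀ r y, G s r y → 1 ≤ b s ∧ y + b s ≤ l r) ∧
      (∀ s < N, ∀ i < b s, i ≤ (o s i).2 ∧ G s (o s i).1 ((o s i).2 - i)) ∧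
      (∀ s < N, ∀ s' < N, ∀ i < b s, ∀ i' < b s', i ≤ (o s' i').2 →
        G s (o s' i').1 ((o s' i').2 - i) → (s = s' ∧ i = i') ∨ ρ s i < ρ s' i') := by
  classical
  set σ : ℕ → ℕ := fun r => ∑ i ∈ range r, l i with hσ
  set τ : ℕ → ℕ := fun s => ∑ i ∈ range s, b i with hτ
  have σs : ∀ r, σ (r + 1) = σ r + l r := fun r => Finset.sum_range_succ _ _
  have τs : ∀ r, τ (r + 1) = τ r + b r := fun r => Finset.sum_range_succ _ _
  have σm : Monotone σ := monotone_nat_of_le_succ fun r => by rw [σs]; omega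
  have τm : Monotone τ := monotone_nat_of_le_succ fun r => by rw [τs]; omega
  have hr : ∀ s, ∃ r, s < N → 1 ≤ b s → σ r ≤ τ s ∧ τ s < σ (r + 1) ∧ b s ≤ l r ∧
      (τ s + b s ≤ σ (r + 1) ∨ b s ≤ l (r + 1)) := by
    intro s
    by_cases hs : s < N ∧ 1 ≤ b s
    · obtain ⟨t, ht, hle⟩ := H s hs.1 hs.2
      change τ (s + 1) ≤ σ t at hle
      rw [τs] at hle
      have hex : ∃ r, τ s < σ (r + 1) := ⟨t, by have : σ t ≤ σ (t + 1) := σm (Nat.le_succ t); omega⟩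
      have h1 := Nat.find_spec hex
      have h2 : σ (Nat.find hex) ≤ τ s := by
        rcases Nat.eq_zero_or_pos (Nat.find hex) with h | h
        · rw [h]; simp [hσ]
        · have := Nat.find_min hex (Nat.sub_lt h one_pos)
          rw [show Nat.find hex - 1 + 1 = Nat.find hex by omega] at this
          omega
      have h3 : Nat.find hex < t := by
        by_contra h
        have := σm (not_lt.mp h)
        omega
      refine ⟨Nat.find hex, fun _ _ => ⟨h2, h1, ht _ h3, ?_⟩⟩
      by_cases h4 : Nat.find hex + 1 < t
      · exact Or.inr (ht _ h4)
      · left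
        have := σm (not_lt.mp h4)
        omega
    · exact ⟨0, fun h1 h2 => absurd ⟨h1, h2⟩ hs⟩
  choose r hr using hr
  refine ⟨fun s r' y => 1 ≤ b s ∧ if τ s + b s ≤ σ (r s + 1) then r' = r s ∧ y = τ s - σ (r s)
      else r' = r s ∧ y + b s = l (r s) ∨ r' = r s + 1 ∧ y = 0,
    fun s i => if τ s + b s ≤ σ (r s + 1) then (r s, τ s - σ (r s) + i)
      else if τ s + b s ≤ σ (r s + 1) + i then (r s, l (r s) - b s + i) else (r s + 1, i),
    fun s i => if τ s + b s ≤ σ (r s + 1) then N + 1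
      else if τ s + b s ≤ σ (r s + 1) + i then s else N - s, ?_, ?_, ?_⟩
  · rintro s hs r' y ⟨hb, hG⟩
    obtain ⟨h1, h2, h3, h4⟩ := hr s hs hb
    have := σs (r s)
    split_ifs at hG with h
    · obtain ⟨rfl, rfl⟩ := hG
      omega
    · rcases hG with ⟨rfl, hy⟩ | ⟨rfl, hy⟩ <;> omega
  · intro s hs i hi
    obtain ⟨h1, h2, h3, h4⟩ := hr s hs (by omega)
    dsimp only
    split_ifs with h h'
    · refine ⟨by dsimp only; omega, by omega, rfl, ?_⟩
      dsimp only; omega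
    · refine ⟨by dsimp only; omega, by omega, Or.inl ⟨rfl, ?_⟩⟩
      dsimp only; omega
    · refine ⟨by dsimp only; omega, by omega, Or.inr ⟨rfl, ?_⟩⟩
      dsimp only; omega
  · intro s hs s' hs' i hi i' hi' hle hG
    obtain ⟨h1, h2, h3, h4⟩ := hr s hs (by omega)
    obtain ⟨h1', h2', h3', h4'⟩ := hr s' hs' (by omega)
    have e1 := σs (r s)
    have e2 := σs (r s')
    have hs1 : s < s' → τ s + b s ≤ τ s' := fun h => by rw [← τs]; exact τm h
    have hs2 : s' < s → τ s' + b s' ≤ τ s := fun h => by rw [← τs]; exact τm h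
    have hs3 : s = s' → τ s = τ s' ∧ b s = b s' := by rintro rfl; exact ⟨rfl, rfl⟩
    have hr1 : r s < r s' → σ (r s + 1) ≤ σ (r s') := fun h => σm h
    have hr2 : r s' < r s → σ (r s' + 1) ≤ σ (r s) := fun h => σm h
    have hr3 : r s = r s' → σ (r s) = σ (r s') ∧ l (r s) = l (r s') :=
      fun h => by rw [h]; exact ⟨rfl, rfl⟩
    have hr4 : r s = r s' + 1 → σ (r s) = σ (r s' + 1) := fun h => by rw [h]
    have hr5 : r s' = r s + 1 → σ (r s') = σ (r s + 1) := fun h => by rw [h]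
    clear_value σ τ
    obtain ⟨-, hG⟩ := hG
    dsimp only at hG hle ⊢
    generalize σ (r s + 1) = σ1 at *
    generalize σ (r s' + 1) = σ1' at *
    generalize σ (r s) = σ0 at *
    generalize σ (r s') = σ0' at *
    generalize l (r s) = l0 at *
    generalize l (r s') = l0' at *
    generalize τ s = t at *
    generalize τ s' = t' at *
    generalize r s = ρ at *
    generalize r s' = ρ' at *
    split_ifs at hG hle ⊢ <;> omega

lemma exists_antitone_enumeration {R : Type} [Fintype R] (l : R → ℕ) :
    ∃ (e : Fin (Fintype.card R) ≃ R) (l' : ℕ → ℕ), Antitone l' ∧ (∀ i : Fin (Fintype.card R), l' i = l (e i)) ∧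
      ∀ i, Fintype.card R ≤ i → l' i = 0 := by
  let e₀ := (Fintype.equivFin R).symm
  let e := (Tuple.sort fun i => OrderDual.toDual (l (e₀ i))).trans e₀
  have he : Antitone fun i => l (e i) :=
    Tuple.monotone_sort fun i => OrderDual.toDual (l (e₀ i))
  refine ⟨e, fun i => if h : i < Fintype.card R then l (e ⟨i, h⟩) else 0, ?_, ?_, ?_⟩
  · intro i j hij
    dsimp only
    split_ifs with h h'
    · exact he hij
    · omega
    · exact Nat.zero_le _
    · exact le_rfl
  · intro i
    simp
  · intro i hi
    exact dif_neg (by omega)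

/-- The family of all shifts of the rows of coefficients `g s`, restricted to the first `l r`
positions of each component `r`. -/
def shiftedRows {R S : Type} (l : R → ℕ) (b : S → ℕ) (g : S → R → ℕ → k)
    (j : Σ s, Fin (b s)) (z : Σ r, Fin (l r)) : k :=
  if (j.2 : ℕ) ≤ z.2 then g j.1 z.1 (z.2 - j.2) else 0

variable (k) in
lemma exists_linearIndependent_shiftedRows {R S : Type} [Fintype R] [Fintype S] (l : R → ℕ)
    (b : S → ℕ) (H : ∀ t, 1 ≤ t →
      (∑ s, if t ≤ b s then b s else 0) ≤ ∑ r, if t ≤ l r then l r else 0) :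
    ∃ g : S → R → ℕ → k, (∀ s r y, g s r y ≠ 0 → 1 ≤ b s ∧ y + b s ≤ l r) ∧
      LinearIndependent k (shiftedRows l b g) := by
  classical
  obtain ⟨e, l', hl', hle, hl0⟩ := exists_antitone_enumeration l
  obtain ⟨e', b', hb', hbe, hb0⟩ := exists_antitone_enumeration b
  obtain ⟨G, o, ρ, hG, ho, hρ⟩ := exists_staircase l' b' (Fintype.card S) (by
    intro s hs hb
    have hex : ∃ i, l' i < b' s := ⟨Fintype.card R, by rw [hl0 _ le_rfl]; exact hb⟩
    have hmin : ∀ r < Nat.find hex, b' s ≤ l' r := fun r hr => not_lt.mp (Nat.find_min hex hr)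
    refine ⟨Nat.find hex, hmin, ?_⟩
    have hcard : Nat.find hex ≤ Fintype.card R :=
      Nat.find_min' hex (by rw [hl0 _ le_rfl]; exact hb)
    have h1 : ∑ i ∈ range (s + 1), b' i ≤
        ∑ i ∈ range (Fintype.card S), if b' s ≤ b' i then b' i else 0 := by
      calc ∑ i ∈ range (s + 1), b' i
          = ∑ i ∈ range (s + 1), if b' s ≤ b' i then b' i else 0 := by
            refine Finset.sum_congr rfl fun i hi => (if_pos (hb' ?_)).symm
            exact Nat.lt_succ_iff.mp (Finset.mem_range.mp hi)
        _ ≤ _ := Finset.sum_le_sum_of_subset (Finset.range_mono hs)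
    have h2 : (∑ i ∈ range (Fintype.card R), if b' s ≤ l' i then l' i else 0) ≤
        ∑ i ∈ range (Nat.find hex), l' i := by
      rw [← Finset.sum_filter]
      refine Finset.sum_le_sum_of_subset fun i hi => ?_
      rw [Finset.mem_filter] at hi
      rw [Finset.mem_range]
      by_contra h
      have := hl' (not_lt.mp h)
      have := Nat.find_spec hex
      omega
    have h3 := H (b' s) hb
    rw [← e.sum_comp, ← e'.sum_comp] at h3
    rw [Finset.sum_range fun i => if b' s ≤ b' i then b' i else 0] at h1
    rw [Finset.sum_range fun i => if b' s ≤ l' i then l' i else 0] at h2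
    simp only [hle] at h2
    simp only [← hbe] at h3
    exact h1.trans (h3.trans h2))
  have hb2 : ∀ s, b' (e'.symm s) = b s := fun s => by rw [hbe, Equiv.apply_symm_apply]
  have hl2 : ∀ r, l' (e.symm r) = l r := fun r => by rw [hle, Equiv.apply_symm_apply]
  have hoR : ∀ s, ∀ i : Fin (b s), ∃ z : Σ r, Fin (l r),
      (o (e'.symm s) i).1 = e.symm z.1 ∧ (o (e'.symm s) i).2 = z.2 := by
    intro s i
    obtain ⟨h1, h2⟩ := ho _ (e'.symm s).2 i (by rw [hb2]; exact i.2)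
    obtain ⟨h3, h4⟩ := hG _ (e'.symm s).2 _ _ h2
    have hr : (o (e'.symm s) i).1 < Fintype.card R := by
      by_contra h
      have := hl0 _ (not_lt.mp h)
      omega
    have h5 := hle ⟨_, hr⟩
    dsimp only at h5
    have := i.2
    rw [hb2] at h4
    exact ⟨⟨e ⟨_, hr⟩, ⟨(o (e'.symm s) i).2, by omega⟩⟩, by simp, rfl⟩
  choose z hz1 hz2 using hoR
  refine ⟨fun s r y => if G (e'.symm s) (e.symm r) y then 1 else 0, ?_, ?_⟩
  · intro s r y h
    rw [← hb2, ← hl2]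
    exact hG _ (e'.symm s).2 _ _ (by simpa using h)
  · refine linearIndependent_of_triangular _ (fun j => z j.1 j.2)
      (fun j => ρ (e'.symm j.1) j.2) ?_ ?_
    · rintro ⟨s, i⟩
      obtain ⟨h1, h2⟩ := ho _ (e'.symm s).2 i (by rw [hb2]; exact i.2)
      rw [hz1 s i, hz2 s i] at h2
      rw [hz2 s i] at h1
      simp [shiftedRows, h1, h2]
    · rintro ⟨s, i⟩ ⟨s', i'⟩ h
      simp only [shiftedRows, ne_eq, ite_eq_right_iff, Classical.not_imp, one_ne_zero,
        not_false_eq_true, and_true] at h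
      have := hρ _ (e'.symm s).2 _ (e'.symm s').2 i (by rw [hb2]; exact i.2) i'
        (by rw [hb2]; exact i'.2) (by rw [hz2 s' i']; exact h.1)
        (by rw [hz1 s' i', hz2 s' i']; exact h.2)
      refine this.imp (fun h => ?_) id
      obtain rfl : s = s' := e'.symm.injective (Fin.ext h.1)
      obtain rfl : i = i' := Fin.ext h.2
      rfl

end Staircase

section Homs

lemma eq_zero_of_vecMul_shiftedRows {R S : Type} {p : R → ℕ} {q : S → ℕ} {u v : ℕ} (e : Fin u ≃ Σ r, Fin (p r))
    (e' : Fin v ≃ Σ s, Fin (q s)) {g : S → R → ℕ → k}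
    (h : LinearIndependent k (shiftedRows p q g)) (w : Fin v → k)
    (hw : w ᵥ* (Matrix.of fun i j => shiftedRows p q g (e' i) (e j)) = 0) : w = 0 := by
  have h1 := Fintype.linearIndependent_iff.mp (h.comp e' e'.injective) w (by
    ext z
    have := congrFun hw (e.symm z)
    simpa [Matrix.vecMul, dotProduct] using this)
  exact funext h1

variable {M N : KRep k} {R S : Type} [DecidableEq R] [DecidableEq S] {p : R → ℕ} {q : S → ℕ}

lemma mulVecLin_surjective_of_vecMul {m n : ℕ} {A : Matrix (Fin m) (Fin n) k}
    (hA : ∀ v, v ᵥ* A = 0 → v = 0) : Function.Surjective A.mulVecLin := by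
  obtain ⟨φ, hφ⟩ := LinearMap.exists_leftInverse_of_injective Aᵀ.mulVecLin (by
    rw [LinearMap.ker_eq_bot']
    intro v hv
    rw [Matrix.mulVecLin_apply, Matrix.mulVec_transpose] at hv
    exact hA v hv)
  have hB : LinearMap.toMatrix' φ * Aᵀ = 1 := by
    rw [← LinearMap.toMatrix'_id, ← hφ, LinearMap.toMatrix'_comp, ← Matrix.toLin'_apply',
      LinearMap.toMatrix'_toLin']
  refine Matrix.mulVec_surjective_iff_exists_right_inverse.mpr ⟨(LinearMap.toMatrix' φ)ᵀ, ?_⟩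
  rw [← Matrix.transpose_one, ← hB, Matrix.transpose_mul, Matrix.transpose_transpose]

lemma KModel.A_row (m : KModel M p) (x : Σ r, Fin (p r)) :
    M.A (m.e1.symm x) = Pi.single (m.e2.symm ⟨x.1, x.2.castSucc⟩) 1 := by
  ext j
  obtain ⟨y, rfl⟩ := m.e2.symm.surjective j
  rw [m.hA, Pi.single_apply]
  refine if_congr ?_ rfl rfl
  rw [m.e2.symm.apply_eq_iff_eq]
  obtain ⟨r, x⟩ := x
  obtain ⟨r', y⟩ := y
  constructor
  · rintro ⟨h, h2⟩
    obtain rfl : r = r' := h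
    obtain rfl : x.castSucc = y := Fin.ext h2
    rfl
  · rintro h
    cases h
    exact ⟨rfl, rfl⟩

lemma KModel.B_row (m : KModel M p) (x : Σ r, Fin (p r)) :
    M.B (m.e1.symm x) = Pi.single (m.e2.symm ⟨x.1, x.2.succ⟩) 1 := by
  ext j
  obtain ⟨y, rfl⟩ := m.e2.symm.surjective j
  rw [m.hB, Pi.single_apply]
  refine if_congr ?_ rfl rfl
  rw [m.e2.symm.apply_eq_iff_eq]
  obtain ⟨r, x⟩ := x
  obtain ⟨r', y⟩ := y
  constructor
  · rintro ⟨h, h2⟩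
    obtain rfl : r = r' := h
    obtain rfl : x.succ = y := Fin.ext h2
    rfl
  · rintro h
    cases h
    exact ⟨rfl, rfl⟩

variable [Fintype R]

/-- The homomorphism given by coefficients `g s r y`, meaning the sum of the maps
`I_{p r} → I_{q s}` obtained from `g s r` by convolution. -/
def KModel.homOfCoeffs (m : KModel M p) (m' : KModel N q) (g : S → R → ℕ → k)
    (hg : ∀ s r y, g s r y ≠ 0 → y + q s ≤ p r) : KHom M N where
  f1 := Matrix.of fun i j => shiftedRows p q g (m'.e1 i) (m.e1 j)
  f2 := Matrix.of fun i j =>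
    shiftedRows (fun r => p r + 1) (fun s => q s + 1) g (m'.e2 i) (m.e2 j)
  comm_a := by
    refine funext fun i => m.row2_injective ?_
    obtain ⟨⟨s, x⟩, rfl⟩ := m'.e1.symm.surjective i
    rw [Matrix.mul_apply_eq_vecMul, Matrix.mul_apply_eq_vecMul, m.row2_vecMul_A, m'.A_row,
      Matrix.single_one_vecMul]
    ext r y
    rw [m.row1_apply, m.row2_apply]
    simp only [Matrix.row_apply, Matrix.of_apply, Equiv.apply_symm_apply]
    simp only [shiftedRows, Fin.val_castSucc]
    have h := hg s r (y - x)
    have := x.2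
    split_ifs <;> first | rfl | (exfalso; omega) | skip
    by_contra h6
    have := h (Ne.symm h6)
    omega
  comm_b := by
    refine funext fun i => m.row2_injective ?_
    obtain ⟨⟨s, x⟩, rfl⟩ := m'.e1.symm.surjective i
    rw [Matrix.mul_apply_eq_vecMul, Matrix.mul_apply_eq_vecMul, m.row2_vecMul_B, m'.B_row,
      Matrix.single_one_vecMul]
    ext r y
    change (if y = 0 then 0 else m.row1 _ r (y - 1)) = _
    rw [m.row1_apply, m.row2_apply]
    simp only [Matrix.row_apply, Matrix.of_apply, Equiv.apply_symm_apply]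
    simp only [shiftedRows, Fin.val_succ]
    rw [show y - 1 - (x : ℕ) = y - (x + 1) by omega]
    split_ifs <;> first | rfl | (exfalso; omega)

variable [Fintype S]

lemma KModel.exists_epi (m : KModel M p) (m' : KModel N q)
    (H : ∀ t, (∑ s, if t ≤ q s then q s + 1 else 0) ≤ ∑ r, if t ≤ p r then p r + 1 else 0) :
    ∃ g : KHom M N, g.Epi := by
  obtain ⟨g, hg, hli⟩ := exists_linearIndependent_shiftedRows k (fun r => p r + 1)
    (fun s => q s + 1) (by
      intro t ht
      obtain ⟨t, rfl⟩ := Nat.exists_eq_add_of_le' ht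
      simpa only [add_le_add_iff_right] using H t)
  refine ⟨m.homOfCoeffs m' g fun s r y h => by have := hg s r y h; omega, ?_⟩
  have h2 : ∀ v, v ᵥ* (m.homOfCoeffs m' g fun s r y h => by have := hg s r y h; omega).f2 = 0 →
      v = 0 := fun v hv => eq_zero_of_vecMul_shiftedRows m.e2 m'.e2 hli v hv
  refine ⟨mulVecLin_surjective_of_vecMul fun v hv => ?_, mulVecLin_surjective_of_vecMul h2⟩
  refine m'.row1_injective ?_
  rw [← m'.row2_vecMul_A, h2 (v ᵥ* N.A), map_zero, map_zero]
  rw [Matrix.vecMul_vecMul, ← KHom.comm_a, ← Matrix.vecMul_vecMul, hv, Matrix.zero_vecMul]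

lemma KModel.exists_mono (m : KModel M p) (m' : KModel N q)
    (H : ∀ t, 1 ≤ t → (∑ s, if t ≤ q s then q s else 0) ≤ ∑ r, if t ≤ p r then p r else 0)
    (heq : ∑ r, p r = ∑ s, q s)
    (h0 : Fintype.card {r // p r = 0} ≤ Fintype.card {s // q s = 0}) :
    ∃ f : KHom M N, f.Mono := by
  classical
  obtain ⟨g, hg, hli⟩ := exists_linearIndependent_shiftedRows k p q H
  obtain ⟨emb⟩ := Function.Embedding.nonempty_of_card_le h0
  set G : S → R → ℕ → k := fun s r y => if q s = 0 then
    (if ∃ h : p r = 0, (emb ⟨r, h⟩ : S) = s ∧ y = 0 then 1 else 0) else g s r y with hG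
  have hGsupp : ∀ s r y, G s r y ≠ 0 → y + q s ≤ p r := by
    intro s r y h
    simp only [hG] at h
    split_ifs at h with h1 h2
    · obtain ⟨h3, -, h4⟩ := h2
      omega
    · exact absurd rfl h
    · exact (hg s r y h).2
  have hrows : shiftedRows p q G = shiftedRows p q g := by
    ext ⟨s, i⟩ z
    have : q s ≠ 0 := by have := i.2; omega
    simp [shiftedRows, hG, this]
  have hinj : Function.Injective (m.homOfCoeffs m' G hGsupp).f1.mulVecLin := by
    have hd : M.d1 = N.d1 := by
      have h1 := Fintype.card_congr m.e1
      have h2 := Fintype.card_congr m'.e1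
      simp only [Fintype.card_sigma, Fintype.card_fin] at h1 h2
      omega
    rw [LinearMap.injective_iff_surjective_of_finrank_eq_finrank (by simp [hd])]
    refine mulVecLin_surjective_of_vecMul fun v hv => ?_
    exact eq_zero_of_vecMul_shiftedRows m.e1 m'.e1 (hrows ▸ hli) v hv
  refine ⟨m.homOfCoeffs m' G hGsupp, hinj, ?_⟩
  set f := m.homOfCoeffs m' G hGsupp with hf
  rw [← LinearMap.ker_eq_bot, LinearMap.ker_eq_bot']
  intro w hw
  rw [Matrix.mulVecLin_apply] at hw
  have hAw : M.A *ᵥ w = 0 := hinj (by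
    rw [map_zero, Matrix.mulVecLin_apply, Matrix.mulVec_mulVec, f.comm_a,
      ← Matrix.mulVec_mulVec, hw, Matrix.mulVec_zero])
  have hBw : M.B *ᵥ w = 0 := hinj (by
    rw [map_zero, Matrix.mulVecLin_apply, Matrix.mulVec_mulVec, f.comm_b,
      ← Matrix.mulVec_mulVec, hw, Matrix.mulVec_zero])
  have hA0 : ∀ x : Σ r, Fin (p r), w (m.e2.symm ⟨x.1, x.2.castSucc⟩) = 0 := by
    intro x
    have := congrFun hAw (m.e1.symm x)
    rwa [Matrix.mulVec, m.A_row, single_one_dotProduct] at this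
  have hB0 : ∀ x : Σ r, Fin (p r), w (m.e2.symm ⟨x.1, x.2.succ⟩) = 0 := by
    intro x
    have := congrFun hBw (m.e1.symm x)
    rwa [Matrix.mulVec, m.B_row, single_one_dotProduct] at this
  have hw0 : ∀ r (y : Fin (p r + 1)), p r ≠ 0 → w (m.e2.symm ⟨r, y⟩) = 0 := by
    intro r y hr
    by_cases hy : (y : ℕ) < p r
    · exact hA0 ⟨r, ⟨y, hy⟩⟩
    · have h1 := hB0 ⟨r, ⟨p r - 1, by omega⟩⟩
      have h2 : (⟨p r - 1, by omega⟩ : Fin (p r)).succ = y :=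
        Fin.ext (by have := y.2; simp only [Fin.succ_mk]; omega)
      rwa [h2] at h1
  ext j
  obtain ⟨⟨r, y⟩, rfl⟩ := m.e2.symm.surjective j
  by_cases hr : p r = 0
  swap
  · exact hw0 r y hr
  have hf2 : ∀ z z', f.f2 (m'.e2.symm z) (m.e2.symm z') =
      shiftedRows (fun r => p r + 1) (fun s => q s + 1) G z z' := by
    intro z z'
    simp [hf, KModel.homOfCoeffs]
  have h1 := congrFun hw (m'.e2.symm ⟨(emb ⟨r, hr⟩ : S), 0⟩)
  rw [Matrix.mulVec, dotProduct, ← m.e2.symm.sum_comp, Finset.sum_eq_single ⟨r, y⟩] at h1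
  · have hy : (y : ℕ) = 0 := by have := y.2; omega
    simpa [hf2, shiftedRows, hG, (emb ⟨r, hr⟩).2, hr, hy] using h1
  · rintro ⟨r', y'⟩ - hne
    by_cases hr' : p r' = 0
    · have : r' ≠ r := by
        rintro rfl
        exact hne (congrArg _ (Fin.ext (by have := y'.2; have := y.2; omega)))
      simp [hf2, shiftedRows, hG, (emb ⟨r, hr⟩).2, hr',
        Subtype.val_inj, this]
    · rw [hw0 r' y' hr', mul_zero]
  · simp

end Homs

section Criterion

lemma cast_sum_ite (a w : ℕ → ℕ) (n t : ℕ) :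
    ((∑ i ∈ range (n + 1), a i * (if t ≤ i then w i else 0) : ℕ) : ℤ) =
      ∑ i ∈ Icc t n, (w i : ℤ) * a i := by
  have : Icc t n = (range (n + 1)).filter fun i => t ≤ i := by
    ext i
    simp only [Finset.mem_Icc, Finset.mem_filter, Finset.mem_range]
    omega
  rw [this, Finset.sum_filter, Nat.cast_sum]
  refine Finset.sum_congr rfl fun i _ => ?_
  split_ifs <;> push_cast <;> ring

lemma criterion_of_isSubfactor {n : ℕ} (hn : 2 ≤ n) (a c : ℕ → ℕ)
    (h : IsSubfactor (KRep.multi k a n) (KRep.multi k c n)) :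
    2 * bone a c n ≤ (∑ i ∈ Finset.Icc 1 n, ((i : ℤ) + 1) * c i) -
      ∑ i ∈ Finset.Icc 2 n, ((i : ℤ) + 1) * bfun a c n i ∧ (a 0 : ℤ) ≤ bzero a c n := by
  obtain ⟨L, ⟨f, hf⟩, g, hg⟩ := h
  obtain ⟨R, _, _, p, ⟨m⟩, hp⟩ := exists_model_multi k c n
  obtain ⟨S, _, _, q, ⟨m'⟩, hq⟩ := exists_model_multi k a n
  obtain ⟨h, h0, h_top, hC, hA, hlast⟩ := exists_hom_dims_of_mono_of_epi m m' g f hg hf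
  have hpn : ∀ r, p r ≤ n := by
    have h1 := hp fun i => if i ≤ n then 0 else 1
    rw [Finset.sum_eq_zero (s := range (n + 1)) fun i hi => by
      rw [if_pos (by rw [Finset.mem_range] at hi; omega), mul_zero]] at h1
    intro r
    have := Finset.sum_eq_zero_iff.mp h1 r (Finset.mem_univ r)
    by_contra hr
    simp [hr] at this
  have hC' : ∀ j, ((∑ r, if j < p r then p r + 1 else 0 : ℕ) : ℤ) =
      ∑ i ∈ Icc (j + 1) n, ((i : ℤ) + 1) * c i := by
    intro j
    rw [hp fun i => if j < i then i + 1 else 0]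
    simpa using cast_sum_ite c (fun i => i + 1) n (j + 1)
  have hA' : ∀ j, ((∑ s, if j < q s then q s else 0 : ℕ) : ℤ) =
      ∑ i ∈ Icc (j + 1) n, (i : ℤ) * a i := by
    intro j
    rw [hq fun i => if j < i then i else 0]
    exact cast_sum_ite a (fun i => i) n (j + 1)
  have hA0 : ((∑ s, if q s = 0 then 1 else 0 : ℕ) : ℤ) = a 0 := by
    rw [hq fun i => if i = 0 then 1 else 0]
    simp
  have hC0 : ((∑ r, (p r + 1) : ℕ) : ℤ) = ∑ i ∈ Icc 0 n, ((i : ℤ) + 1) * c i := by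
    rw [hp fun i => i + 1]
    simpa using cast_sum_ite c (fun i => i + 1) n 0
  have hsum : (h 0 : ℤ) = ∑ i ∈ Icc 1 n, (i : ℤ) * a i := by
    rw [h0, hq fun i => i, ← cast_sum_ite a (fun i => i) n 1]
    refine congrArg _ (Finset.sum_congr rfl fun i _ => ?_)
    split_ifs with hi
    · rfl
    · rw [show i = 0 by omega]
  have hopt := greedy_optimal a c (n := n) (fun t => (h (t - 1) : ℤ))
    (by simpa using h_top n hpn)
    (by
      intro t ht htn
      obtain ⟨t, rfl⟩ := Nat.exists_eq_add_of_le' (show 1 ≤ t by omega)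
      have h1 := hC t
      rw [hC'] at h1
      simp only [Nat.add_sub_cancel]
      push_cast at h1 ⊢
      linarith)
    (by
      intro t ht htn
      obtain ⟨t, rfl⟩ := Nat.exists_eq_add_of_le' (show 1 ≤ t by omega)
      have h1 := hA t
      rw [hA'] at h1
      simp only [Nat.add_sub_cancel]
      push_cast at h1 ⊢
      linarith)
    (le_refl 2) (by omega)
  have hsplit : ∑ i ∈ Icc 2 n, ((i : ℤ) - (((2 : ℕ) : ℤ) - 1)) * bfun a c n i =
      2 * ∑ i ∈ Icc 2 n, (i : ℤ) * bfun a c n i -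
        ∑ i ∈ Icc 2 n, ((i : ℤ) + 1) * bfun a c n i := by
    rw [Finset.mul_sum, ← Finset.sum_sub_distrib]
    refine Finset.sum_congr rfl fun i _ => ?_
    push_cast
    ring
  have hC1 := hC 0
  rw [hC'] at hC1
  rw [hA0, hC0] at hlast
  rw [hsplit] at hopt
  simp only [Nat.reduceSub, Nat.cast_zero, zero_add, one_mul] at hopt hC1
  simp only [bzero, bone]
  constructor <;> linarith

lemma bfull_spec {n : ℕ} (hn : 2 ≤ n) (a c : ℕ → ℕ)
    (h1 : 2 * bone a c n ≤ (∑ i ∈ Finset.Icc 1 n, ((i : ℤ) + 1) * c i) -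
      ∑ i ∈ Finset.Icc 2 n, ((i : ℤ) + 1) * bfun a c n i) (h0 : (a 0 : ℤ) ≤ bzero a c n) :
    (∀ t ≤ n, 0 ≤ bfull a c n t) ∧
    (∀ t, 1 ≤ t → ∑ i ∈ Icc t n, (i : ℤ) * bfull a c n i ≤ ∑ i ∈ Icc t n, (i : ℤ) * a i) ∧
    (∑ i ∈ Icc 1 n, (i : ℤ) * bfull a c n i = ∑ i ∈ Icc 1 n, (i : ℤ) * a i) ∧
    (∀ t, ∑ i ∈ Icc t n, ((i : ℤ) + 1) * bfull a c n i ≤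
      ∑ i ∈ Icc t n, ((i : ℤ) + 1) * c i) := by
  have hsum : ∀ w : ℕ → ℤ, ∀ t, 2 ≤ t →
      ∑ i ∈ Icc t n, w i * bfull a c n i = ∑ i ∈ Icc t n, w i * bfun a c n i := by
    intro w t ht
    refine Finset.sum_congr rfl fun i hi => ?_
    have := (Finset.mem_Icc.mp hi).1
    rw [bfull, if_neg (by omega), if_neg (by omega)]
  have hsum1 : ∀ w : ℕ → ℤ, ∑ i ∈ Icc 1 n, w i * bfull a c n i =
      w 1 * bone a c n + ∑ i ∈ Icc 2 n, w i * bfun a c n i := by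
    intro w
    rw [sum_Icc_eq_add_sum_Icc_succ (fun i => w i * bfull a c n i) (by omega),
      hsum w _ le_rfl, bfull, if_neg one_ne_zero, if_pos rfl]
  have heq : ∑ i ∈ Icc 1 n, (i : ℤ) * bfull a c n i = ∑ i ∈ Icc 1 n, (i : ℤ) * a i := by
    rw [hsum1, bone]
    push_cast
    ring
  refine ⟨?_, ?_, heq, ?_⟩
  · intro t ht
    rw [bfull]
    split_ifs with h h'
    · exact (Nat.cast_nonneg _).trans h0
    · have := (bfun_spec a c one_le_two hn).1
      rw [bone, sum_Icc_eq_add_sum_Icc_succ (fun i => (i : ℤ) * a i) (show 1 ≤ n by omega)]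
      have h3 : (0 : ℤ) ≤ (1 : ℕ) * a 1 := by positivity
      simp only [Nat.reduceAdd]
      linarith
    · exact bfun_nonneg a c (by omega) ht
  · intro t ht
    rcases ht.eq_or_lt with rfl | ht
    · exact heq.le
    rcases le_or_gt t n with htn | htn
    · rw [hsum _ _ ht]
      exact (bfun_spec a c (by omega) htn).1
    · simp [Finset.Icc_eq_empty_of_lt htn]
  · intro t
    rcases le_or_gt t n with htn | htn
    · rcases lt_or_ge t 2 with ht | ht
      · have h2 : ∑ i ∈ Icc 1 n, ((i : ℤ) + 1) * bfull a c n i ≤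
            ∑ i ∈ Icc 1 n, ((i : ℤ) + 1) * c i := by
          rw [hsum1 fun i => (i : ℤ) + 1]
          push_cast
          linarith
        interval_cases t
        · rw [sum_Icc_eq_add_sum_Icc_succ (fun i => ((i : ℤ) + 1) * bfull a c n i) htn, zero_add,
            hsum1 fun i => (i : ℤ) + 1, bfull, if_pos rfl, bzero]
          push_cast
          linarith
        · exact h2
      · rw [hsum (fun i => (i : ℤ) + 1) _ ht]
        exact (bfun_spec a c (by omega) htn).2.1
    · simp [Finset.Icc_eq_empty_of_lt htn]

lemma exists_mono_and_epi {n : ℕ} (hn : 2 ≤ n) (a c : ℕ → ℕ)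
    (h1 : 2 * bone a c n ≤ (∑ i ∈ Finset.Icc 1 n, ((i : ℤ) + 1) * c i) -
      ∑ i ∈ Finset.Icc 2 n, ((i : ℤ) + 1) * bfun a c n i) (h0 : (a 0 : ℤ) ≤ bzero a c n) :
    (∃ f : KHom (KRep.multi k a n)
      (KRep.multi k (fun i => (bfull a c n i).toNat) n), f.Mono) ∧
    (∃ g : KHom (KRep.multi k c n)
      (KRep.multi k (fun i => (bfull a c n i).toNat) n), g.Epi) := by
  obtain ⟨hnn, hA, hA1, hC⟩ := bfull_spec hn a c h1 h0
  obtain ⟨R, _, _, p, ⟨m⟩, hp⟩ := exists_model_multi k c n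
  obtain ⟨S, _, _, q, ⟨m'⟩, hq⟩ := exists_model_multi k a n
  obtain ⟨T, _, _, u, ⟨m''⟩, hu⟩ := exists_model_multi k (fun i => (bfull a c n i).toNat) n
  have hcast : ∀ w : ℕ → ℤ, ∀ t, ∑ i ∈ Icc t n, w i * ((bfull a c n i).toNat : ℤ) =
      ∑ i ∈ Icc t n, w i * bfull a c n i := fun w t => Finset.sum_congr rfl fun i hi => by
    rw [Int.toNat_of_nonneg (hnn i (Finset.mem_Icc.mp hi).2)]
  have hone : ∀ v : ℕ → ℕ, ((∑ i ∈ range (n + 1), v i * i : ℕ) : ℤ) =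
      ∑ i ∈ Icc 1 n, (i : ℤ) * v i := by
    intro v
    rw [← cast_sum_ite v (fun i => i) n 1]
    refine congrArg _ (Finset.sum_congr rfl fun i _ => ?_)
    split_ifs with hi
    · rfl
    · rw [show i = 0 by omega]
  constructor
  · refine m'.exists_mono m'' ?_ ?_ ?_
    · intro t ht
      rw [hu fun i => if t ≤ i then i else 0, hq fun i => if t ≤ i then i else 0]
      have e1 := cast_sum_ite (fun i => (bfull a c n i).toNat) (fun i => i) n t
      rw [hcast] at e1
      exact Int.ofNat_le.mp
        (e1.trans_le ((hA t ht).trans (cast_sum_ite a (fun i => i) n t).ge))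
    · apply Int.ofNat_inj.mp
      rw [hq fun i => i, hu fun i => i, hone, hone, hcast, hA1]
    · rw [Fintype.card_subtype, Fintype.card_subtype, Finset.card_filter, Finset.card_filter,
        hq fun i => if i = 0 then 1 else 0, hu fun i => if i = 0 then 1 else 0]
      have : (a 0 : ℤ) ≤ bfull a c n 0 := h0
      simp only [mul_ite, mul_one, mul_zero, Finset.sum_ite_eq', Finset.mem_range]
      simp
      omega
  · refine m.exists_epi m'' fun t => ?_
    rw [hu fun i => if t ≤ i then i + 1 else 0, hp fun i => if t ≤ i then i + 1 else 0]
    have e1 := cast_sum_ite (fun i => (bfull a c n i).toNat) (fun i => i + 1) n t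
    have e2 := cast_sum_ite c (fun i => i + 1) n t
    have e3 := hcast (fun i => (i : ℤ) + 1) t
    have e4 := hC t
    simp only [Nat.cast_add, Nat.cast_one] at e1 e2
    rw [e3] at e1
    exact Int.ofNat_le.mp (e1.trans_le (e4.trans e2.ge))

end Criterion

/-- Main theorem (subfactor criterion for preinjective Kronecker modules):
`I′ = aₙIₙ ⊕ ⋯ ⊕ a₀I₀` is a subfactor of `I = cₙIₙ ⊕ ⋯ ⊕ c₀I₀` iff
`2·b₁ ≤ Σ_{i=1}^n (i+1)·cᵢ − Σ_{i=2}^n (i+1)·bᵢ` and `b₀ ≥ a₀`, where the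
`b_t` are given by the greedy recursion.  Moreover, in this case all `b_t`
are non-negative and `L = bₙIₙ ⊕ ⋯ ⊕ b₀I₀` is a linking module. -/
theorem preinjective_subfactor_criterion (n : ℕ) (hn : 2 ≤ n) (a c : ℕ → ℕ) :
    (IsSubfactor (KRep.multi k a n) (KRep.multi k c n) ↔
      (2 * bone a c n ≤
        (∑ i ∈ Finset.Icc 1 n, ((i : ℤ) + 1) * c i) -
          ∑ i ∈ Finset.Icc 2 n, ((i : ℤ) + 1) * bfun a c n i ∧
       (a 0 : ℤ) ≤ bzero a c n)) ∧
    ((2 * bone a c n ≤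
        (∑ i ∈ Finset.Icc 1 n, ((i : ℤ) + 1) * c i) -
          ∑ i ∈ Finset.Icc 2 n, ((i : ℤ) + 1) * bfun a c n i ∧
      (a 0 : ℤ) ≤ bzero a c n) →
      (∀ t, t ≤ n → 0 ≤ bfull a c n t) ∧
      (∃ f : KHom (KRep.multi k a n)
          (KRep.multi k (fun i => (bfull a c n i).toNat) n), f.Mono) ∧
      (∃ g : KHom (KRep.multi k c n)
          (KRep.multi k (fun i => (bfull a c n i).toNat) n), g.Epi)) := by
  refine ⟨⟨fun h => criterion_of_isSubfactor hn a c h, fun h => ?_⟩, fun h => ?_⟩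
  · exact ⟨_, exists_mono_and_epi hn a c h.1 h.2⟩
  · exact ⟨(bfull_spec hn a c h.1 h.2).1, exists_mono_and_epi hn a c h.1 h.2⟩
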